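/- arXiv:1101.3808 — 2 statements merged into one kernel-verified Lean document; each statement's English description precedes it below -/
import Mathlib

section
/- For all integers l ≥ 1, s₁ ≥ 0, s₂ ≥ 0 and all i ∈ ℤ the following identity holds: S^l_{s₁}(i) + Σ_{j=1}^{l−1} (−1)^j S^{l−j}_{s₁}(i) T^j_{s₂}(i + (l−j)n) + (−1)^l T^l_{s₂}(i) = S^l_{s₁}(i + (s₂+1)(p−n)) + Σ_{j=1}^{l−1} (−1)^j S^{l−j}_{s₁}(i + (s₂+1)(p−n) + jn) T^j_{s₂}(i + (s₁+1)(p−n)) + (−1)^l T^l_{s₂}(i + (s₁+1)(p−n)). -/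
variable {R : Type*} [CommRing R]

/-- `Spoly n p r l s i` is the discrete polynomial
`S^l_s(i) = Σ_{1 ≤ λ_l ≤ … ≤ λ_1 ≤ s+1} Π_{j=1}^{l} r(i + (p−n)λ_j + jn − p)`,
the sum ranging over weakly decreasing `l`-tuples `λ_1 ≥ … ≥ λ_l` in `{1, …, s+1}`.
For `l = 0` this gives `S^0_s(i) = 1` for every `s ≥ -1`, as in the convention. -/
noncomputable def Spoly (n p : ℤ) (r : ℤ → R) (l : ℕ) (s i : ℤ) : R :=
  ∑ lam ∈ Finset.filter (fun lam : Fin l → ℤ => ∀ j k : Fin l, j ≤ k → lam k ≤ lam j)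
      (Fintype.piFinset fun _ : Fin l => Finset.Icc (1 : ℤ) (s + 1)),
    ∏ j : Fin l, r (i + (p - n) * lam j + (((j : ℕ) : ℤ) + 1) * n - p)

/-- `Tpoly n p r l s i` is the discrete polynomial
`T^l_s(i) = Σ_{1 ≤ λ_1 < … < λ_l ≤ s+1} Π_{j=1}^{l} r(i + (p−n)λ_j + jn − p)`,
the sum ranging over strictly increasing `l`-tuples in `{1, …, s+1}`.
For `l = 0` this gives `T^0_s(i) = 1` for every `s ≥ -1`, and for `l ≥ 1` and
`-1 ≤ s ≤ l-2` the sum is empty, so `T^l_s(i) = 0`, as in the convention. -/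
noncomputable def Tpoly (n p : ℤ) (r : ℤ → R) (l : ℕ) (s i : ℤ) : R :=
  ∑ lam ∈ Finset.filter (fun lam : Fin l → ℤ => ∀ j k : Fin l, j < k → lam j < lam k)
      (Fintype.piFinset fun _ : Fin l => Finset.Icc (1 : ℤ) (s + 1)),
    ∏ j : Fin l, r (i + (p - n) * lam j + (((j : ℕ) : ℤ) + 1) * n - p)

/-- Recursion on the largest index `λ_1 ≤ s + 1`. -/
theorem Spoly_succ (n p : ℤ) (r : ℤ → R) (l : ℕ) (s i : ℤ) (hs : 0 ≤ s) :
    Spoly n p r (l + 1) s i = Spoly n p r (l + 1) (s - 1) i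
      + r (i + (p - n) * (s + 1) + n - p) * Spoly n p r l s (i + n) := by
  unfold Spoly
  rw [← Finset.sum_filter_not_add_sum_filter _ (fun lam : Fin (l + 1) → ℤ => lam 0 = s + 1)]
  congr 1
  · refine Finset.sum_congr ?_ fun _ _ => rfl
    ext lam
    simp only [Finset.mem_filter, Fintype.mem_piFinset, Finset.mem_Icc]
    constructor
    · rintro ⟨⟨hb, hm⟩, h0⟩
      refine ⟨fun j => ?_, hm⟩
      have := hm 0 j (Fin.zero_le j)
      have := hb 0
      have := hb j
      lia
    · rintro ⟨hb, hm⟩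
      refine ⟨⟨fun j => ?_, hm⟩, ?_⟩
      · have := hb j
        lia
      · have := hb 0
        lia
  · rw [Finset.mul_sum]
    refine Finset.sum_nbij' Fin.tail (fun mu => Fin.cons (s + 1) mu) ?_ ?_ ?_ ?_ ?_
    · simp only [Finset.mem_filter, Fintype.mem_piFinset]
      rintro lam ⟨⟨hb, hm⟩, -⟩
      exact ⟨fun j => hb j.succ, fun j k hjk => hm _ _ (Fin.succ_le_succ_iff.2 hjk)⟩
    · simp only [Finset.mem_filter, Fintype.mem_piFinset, Finset.mem_Icc]
      rintro mu ⟨hb, hm⟩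
      refine ⟨⟨fun j => ?_, fun j k hjk => ?_⟩, rfl⟩
      · cases j using Fin.cases with
        | zero => simp only [Fin.cons_zero]; lia
        | succ j => simpa using hb j
      · cases k using Fin.cases with
        | zero => rw [Fin.le_zero_iff.1 hjk]
        | succ k =>
          cases j using Fin.cases with
          | zero => simpa using (hb k).2
          | succ j => simpa using hm j k (Fin.succ_le_succ_iff.1 hjk)
    · simp only [Finset.mem_filter]
      rintro lam ⟨-, h0⟩
      rw [← h0, Fin.cons_self_tail]
    · intro mu _
      exact Fin.tail_cons _ _
    · simp only [Finset.mem_filter]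
      rintro lam ⟨-, h0⟩
      rw [Fin.prod_univ_succ, h0]
      congr 1
      · congr 1
        simp
      · refine Finset.prod_congr rfl fun j _ => congrArg r ?_
        simp only [Fin.tail, Fin.val_succ]
        push_cast
        ring

/-- Recursion on the largest index `λ_l ≤ s + 1`. -/
theorem Tpoly_succ (n p : ℤ) (r : ℤ → R) (l : ℕ) (s i : ℤ) (hs : 0 ≤ s) :
    Tpoly n p r (l + 1) s i = Tpoly n p r (l + 1) (s - 1) i
      + Tpoly n p r l (s - 1) i * r (i + (p - n) * (s + 1) + ((l : ℤ) + 1) * n - p) := by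
  unfold Tpoly
  rw [← Finset.sum_filter_not_add_sum_filter _
    (fun lam : Fin (l + 1) → ℤ => lam (Fin.last l) = s + 1)]
  congr 1
  · refine Finset.sum_congr ?_ fun _ _ => rfl
    ext lam
    simp only [Finset.mem_filter, Fintype.mem_piFinset, Finset.mem_Icc]
    constructor
    · rintro ⟨⟨hb, hm⟩, h0⟩
      refine ⟨fun j => ?_, hm⟩
      have hl := hb (Fin.last l)
      have hj := hb j
      rcases (Fin.le_last j).eq_or_lt with rfl | hlt
      · lia
      · have := hm j _ hlt
        lia
    · rintro ⟨hb, hm⟩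
      refine ⟨⟨fun j => ?_, hm⟩, ?_⟩
      · have := hb j
        lia
      · have := hb (Fin.last l)
        lia
  · rw [Finset.sum_mul]
    refine Finset.sum_nbij' Fin.init (fun mu => Fin.snoc (α := fun _ => ℤ) mu (s + 1))
      ?_ ?_ ?_ ?_ ?_
    · simp only [Finset.mem_filter, Fintype.mem_piFinset, Finset.mem_Icc]
      rintro lam ⟨⟨hb, hm⟩, h0⟩
      refine ⟨fun j => ?_, fun j k hjk => hm _ _ (Fin.castSucc_lt_castSucc_iff.2 hjk)⟩
      have := hb j.castSucc
      have := hm _ _ (Fin.castSucc_lt_last j)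
      simp only [Fin.init]
      lia
    · simp only [Finset.mem_filter, Fintype.mem_piFinset, Finset.mem_Icc]
      rintro mu ⟨hb, hm⟩
      refine ⟨⟨fun j => ?_, fun j k hjk => ?_⟩, Fin.snoc_last _ _⟩
      · cases j using Fin.lastCases with
        | last => simp only [Fin.snoc_last]; lia
        | cast j =>
          have := hb j
          simp only [Fin.snoc_castSucc]
          lia
      · cases j using Fin.lastCases with
        | last => exact absurd hjk (Fin.le_last k).not_gt
        | cast j =>
          cases k using Fin.lastCases with
          | last =>
            have := hb j
            simp only [Fin.snoc_castSucc, Fin.snoc_last]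
            lia
          | cast k => simpa using hm j k (Fin.castSucc_lt_castSucc_iff.1 hjk)
    · simp only [Finset.mem_filter]
      rintro lam ⟨-, h0⟩
      rw [← h0, Fin.snoc_init_self]
    · intro mu _
      exact Fin.init_snoc _ _
    · simp only [Finset.mem_filter]
      rintro lam ⟨-, h0⟩
      rw [Fin.prod_univ_castSucc, h0]
      rfl

theorem Spoly_zero (n p : ℤ) (r : ℤ → R) (s i : ℤ) : Spoly n p r 0 s i = 1 := by
  simp [Spoly]

theorem Tpoly_zero (n p : ℤ) (r : ℤ → R) (s i : ℤ) : Tpoly n p r 0 s i = 1 := by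
  simp [Tpoly]

theorem Spoly_succ_neg_one (n p : ℤ) (r : ℤ → R) (l : ℕ) (i : ℤ) :
    Spoly n p r (l + 1) (-1) i = 0 := by
  refine Finset.sum_eq_zero fun lam h => ?_
  simp only [Finset.mem_filter, Fintype.mem_piFinset, Finset.mem_Icc] at h
  have := h.1 0
  lia

theorem Tpoly_succ_neg_one (n p : ℤ) (r : ℤ → R) (l : ℕ) (i : ℤ) :
    Tpoly n p r (l + 1) (-1) i = 0 := by
  refine Finset.sum_eq_zero fun lam h => ?_
  simp only [Finset.mem_filter, Fintype.mem_piFinset, Finset.mem_Icc] at h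
  have := h.1 0
  lia

/-- The endomorphism `g ↦ f · g(· + m)` of `ℤ → R`: a shift followed by a multiplication. -/
def mulShift (m : ℤ) (f : ℤ → R) : Module.End R (ℤ → R) where
  toFun g i := f i * g (i + m)
  map_add' g h := by ext i; simp [mul_add]
  map_smul' c g := by ext i; simp [mul_left_comm]

theorem mulShift_apply (m : ℤ) (f g : ℤ → R) (i : ℤ) : mulShift m f g i = f i * g (i + m) := rfl

/-- The generating series of a sequence of functions, in which the degree `l` term shifts its
argument by `l * n`. -/
noncomputable def skewSeries (n : ℤ) (F : ℕ → ℤ → R) : PowerSeries (Module.End R (ℤ → R)) :=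
  PowerSeries.mk fun l => mulShift ((l : ℤ) * n) (F l)

/-- The series `1 - x X`, where `x` multiplies by `r (· + (p - n) * k + n - p)` and shifts
by `n`. -/
noncomputable def linFactor (n p : ℤ) (r : ℤ → R) (k : ℤ) :
    PowerSeries (Module.End R (ℤ → R)) :=
  1 - PowerSeries.C (mulShift n fun i => r (i + (p - n) * k + n - p)) * PowerSeries.X

theorem PowerSeries.isUnit_one_sub_C_mul_X {A : Type*} [Ring A] (x : A) :
    IsUnit (1 - PowerSeries.C x * PowerSeries.X : PowerSeries A) := by
  have h₁ : (1 - PowerSeries.C x * PowerSeries.X) * PowerSeries.mk (x ^ ·) = 1 := by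
    ext (_ | k)
    · simp [sub_mul, mul_assoc]
    · rw [sub_mul, one_mul, mul_assoc, map_sub, PowerSeries.coeff_C_mul,
        PowerSeries.coeff_succ_X_mul]
      simp [pow_succ', PowerSeries.coeff_one]
  have h₂ : PowerSeries.mk (x ^ ·) * (1 - PowerSeries.C x * PowerSeries.X) = 1 := by
    ext (_ | k)
    · simp [mul_sub, ← mul_assoc]
    · rw [mul_sub, mul_one, ← mul_assoc, map_sub, PowerSeries.coeff_succ_mul_X,
        PowerSeries.coeff_mul_C]
      simp [pow_succ, PowerSeries.coeff_one]
  exact ⟨⟨_, _, h₁, h₂⟩, rfl⟩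

/-- The signed generating series of `T^l_{b-1}(· + c (p - n))`. -/
noncomputable def Tseries (n p : ℤ) (r : ℤ → R) (c : ℤ) (b : ℕ) :
    PowerSeries (Module.End R (ℤ → R)) :=
  skewSeries n fun l i => (-1) ^ l * Tpoly n p r l (b - 1) (i + c * (p - n))

/-- The generating series of `S^l_{a-1}(· + c (p - n))`. -/
noncomputable def Sseries (n p : ℤ) (r : ℤ → R) (c : ℤ) (a : ℕ) :
    PowerSeries (Module.End R (ℤ → R)) :=
  skewSeries n fun l i => Spoly n p r l (a - 1) (i + c * (p - n))

theorem Tseries_zero (n p : ℤ) (r : ℤ → R) (c : ℤ) : Tseries n p r c 0 = 1 := by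
  ext (_ | l) g i <;>
    simp [Tseries, skewSeries, mulShift_apply, Tpoly_zero, Tpoly_succ_neg_one,
      PowerSeries.coeff_one]

theorem Sseries_zero (n p : ℤ) (r : ℤ → R) (c : ℤ) : Sseries n p r c 0 = 1 := by
  ext (_ | l) g i <;>
    simp [Sseries, skewSeries, mulShift_apply, Spoly_zero, Spoly_succ_neg_one,
      PowerSeries.coeff_one]

theorem Tseries_succ (n p : ℤ) (r : ℤ → R) (c : ℤ) (b : ℕ) :
    Tseries n p r c (b + 1) = Tseries n p r c b * linFactor n p r (c + b + 1) := by
  ext (_ | l) g i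
  · simp [Tseries, linFactor, skewSeries, mulShift_apply, Tpoly_zero, mul_sub, ← mul_assoc]
  · rw [linFactor, mul_sub, mul_one, ← mul_assoc, map_sub, PowerSeries.coeff_succ_mul_X,
      PowerSeries.coeff_mul_C]
    simp only [Tseries, skewSeries, PowerSeries.coeff_mk, LinearMap.sub_apply, Pi.sub_apply,
      Module.End.mul_apply, mulShift_apply]
    rw [Tpoly_succ _ _ _ _ _ _ (by lia)]
    have e₁ : ((b + 1 : ℕ) : ℤ) - 1 - 1 = b - 1 := by lia
    have e₂ : i + c * (p - n) + (p - n) * (((b + 1 : ℕ) : ℤ) - 1 + 1) + ((l : ℤ) + 1) * n - p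
        = i + (l : ℤ) * n + (p - n) * (c + b + 1) + n - p := by push_cast; ring
    have e₃ : i + ((l + 1 : ℕ) : ℤ) * n = i + (l : ℤ) * n + n := by push_cast; ring
    rw [e₁, e₂, e₃]
    ring

theorem linFactor_mul_Sseries_succ (n p : ℤ) (r : ℤ → R) (c : ℤ) (a : ℕ) :
    linFactor n p r (c + a + 1) * Sseries n p r c (a + 1) = Sseries n p r c a := by
  ext (_ | l) g i
  · simp [Sseries, linFactor, skewSeries, mulShift_apply, Spoly_zero, sub_mul, mul_assoc]
  · rw [linFactor, sub_mul, one_mul, mul_assoc, map_sub, PowerSeries.coeff_C_mul,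
      PowerSeries.coeff_succ_X_mul]
    simp only [Sseries, skewSeries, PowerSeries.coeff_mk, LinearMap.sub_apply, Pi.sub_apply,
      Module.End.mul_apply, mulShift_apply]
    rw [Spoly_succ _ _ _ _ _ _ (by lia)]
    have e₁ : ((a + 1 : ℕ) : ℤ) - 1 - 1 = a - 1 := by lia
    have e₂ : i + c * (p - n) + (p - n) * (((a + 1 : ℕ) : ℤ) - 1 + 1) + n - p
        = i + (p - n) * (c + a + 1) + n - p := by push_cast; ring
    have e₃ : i + ((l + 1 : ℕ) : ℤ) * n = i + n + (l : ℤ) * n := by push_cast; ring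
    have e₄ : i + c * (p - n) + n = i + n + c * (p - n) := by ring
    rw [e₁, e₂, e₃, e₄]
    ring

theorem Tseries_mul_Sseries (n p : ℤ) (r : ℤ → R) (c : ℤ) (a : ℕ) :
    Tseries n p r c a * Sseries n p r c a = 1 := by
  induction a with
  | zero => rw [Tseries_zero, Sseries_zero, one_mul]
  | succ a ih => rw [Tseries_succ, mul_assoc, linFactor_mul_Sseries_succ, ih]

theorem isUnit_Tseries (n p : ℤ) (r : ℤ → R) (c : ℤ) (a : ℕ) : IsUnit (Tseries n p r c a) := by
  induction a with
  | zero => rw [Tseries_zero]; exact isUnit_one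
  | succ a ih => rw [Tseries_succ]; exact ih.mul (PowerSeries.isUnit_one_sub_C_mul_X _)

theorem Sseries_mul_Tseries (n p : ℤ) (r : ℤ → R) (c : ℤ) (a : ℕ) :
    Sseries n p r c a * Tseries n p r c a = 1 := by
  refine (isUnit_Tseries n p r c a).mul_left_cancel ?_
  rw [← mul_assoc, Tseries_mul_Sseries, one_mul, mul_one]

theorem Tseries_add (n p : ℤ) (r : ℤ → R) (c : ℤ) (a b : ℕ) :
    Tseries n p r c (a + b) = Tseries n p r c a * Tseries n p r (c + a) b := by
  induction b with
  | zero => rw [Tseries_zero, mul_one, add_zero]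
  | succ b ih =>
    rw [← add_assoc, Tseries_succ, Tseries_succ, ih, mul_assoc]
    push_cast
    simp only [add_assoc]

theorem Sseries_mul_Tseries_comm (n p : ℤ) (r : ℤ → R) (c : ℤ) (a b : ℕ) :
    Sseries n p r c a * Tseries n p r c b
      = Tseries n p r (c + a) b * Sseries n p r (c + b) a := by
  have h : Tseries n p r c a * Tseries n p r (c + a) b
      = Tseries n p r c b * Tseries n p r (c + b) a := by
    rw [← Tseries_add, ← Tseries_add, add_comm]
  calc Sseries n p r c a * Tseries n p r c b
      = Sseries n p r c a * (Tseries n p r c b * Tseries n p r (c + b) a)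
          * Sseries n p r (c + b) a := by
        rw [mul_assoc, mul_assoc, Tseries_mul_Sseries, mul_one]
    _ = Tseries n p r (c + a) b * Sseries n p r (c + b) a := by
        rw [← h, ← mul_assoc, Sseries_mul_Tseries, one_mul]

theorem coeff_skewSeries_mul_apply_one (n : ℤ) (F G : ℕ → ℤ → R) (l : ℕ) (i : ℤ) :
    PowerSeries.coeff l (skewSeries n F * skewSeries n G) 1 i
      = ∑ q ∈ Finset.HasAntidiagonal.antidiagonal l, F q.1 i * G q.2 (i + (q.1 : ℤ) * n) := by
  rw [PowerSeries.coeff_mul, LinearMap.sum_apply, Finset.sum_apply]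
  simp [skewSeries, mulShift_apply]

theorem sum_range_succ_eq_ends_add_sum_Icc {l : ℕ} (hl : 1 ≤ l) (f : ℕ → R) :
    ∑ j ∈ Finset.range (l + 1), f j = f 0 + ∑ j ∈ Finset.Icc 1 (l - 1), f j + f l := by
  obtain ⟨m, rfl⟩ := Nat.exists_eq_add_of_le' hl
  rw [Finset.sum_range_succ, Finset.range_eq_Ico, Finset.sum_eq_sum_Ico_succ_bot (by lia)]
  rfl

/-- Identity (27) of the paper: for `l ≥ 1`, `s₁, s₂ ≥ 0` and all `i ∈ ℤ`,
`S^l_{s₁}(i) + Σ_{j=1}^{l-1} (-1)^j S^{l-j}_{s₁}(i) T^j_{s₂}(i + (l-j)n) + (-1)^l T^l_{s₂}(i)`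
equals
`S^l_{s₁}(i + (s₂+1)(p-n))
 + Σ_{j=1}^{l-1} (-1)^j S^{l-j}_{s₁}(i + (s₂+1)(p-n) + jn) T^j_{s₂}(i + (s₁+1)(p-n))
 + (-1)^l T^l_{s₂}(i + (s₁+1)(p-n))`. -/
theorem ST_form_identity (n p : ℤ) (hn : 1 ≤ n) (hp : n < p) (r : ℤ → R)
    (l : ℕ) (hl : 1 ≤ l) (s₁ s₂ : ℤ) (hs₁ : 0 ≤ s₁) (hs₂ : 0 ≤ s₂) (i : ℤ) :
    Spoly n p r l s₁ i
      + (∑ j ∈ Finset.Icc 1 (l - 1), (-1 : R) ^ j * Spoly n p r (l - j) s₁ i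
          * Tpoly n p r j s₂ (i + ((l : ℤ) - (j : ℤ)) * n))
      + (-1 : R) ^ l * Tpoly n p r l s₂ i
    = Spoly n p r l s₁ (i + (s₂ + 1) * (p - n))
      + (∑ j ∈ Finset.Icc 1 (l - 1),
          (-1 : R) ^ j * Spoly n p r (l - j) s₁ (i + (s₂ + 1) * (p - n) + (j : ℤ) * n)
            * Tpoly n p r j s₂ (i + (s₁ + 1) * (p - n)))
      + (-1 : R) ^ l * Tpoly n p r l s₂ (i + (s₁ + 1) * (p - n)) := by
  obtain ⟨a, rfl⟩ : ∃ a : ℕ, s₁ = a - 1 := ⟨(s₁ + 1).toNat, by lia⟩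
  obtain ⟨b, rfl⟩ : ∃ b : ℕ, s₂ = b - 1 := ⟨(s₂ + 1).toNat, by lia⟩
  have key := congrArg
    (fun P : PowerSeries (Module.End R (ℤ → R)) => PowerSeries.coeff l P 1 i)
    (Sseries_mul_Tseries_comm n p r 0 a b)
  simp only [Sseries, Tseries, coeff_skewSeries_mul_apply_one] at key
  rw [← Finset.Nat.sum_antidiagonal_swap, Finset.Nat.sum_antidiagonal_eq_sum_range_succ_mk,
    Finset.Nat.sum_antidiagonal_eq_sum_range_succ_mk,
    sum_range_succ_eq_ends_add_sum_Icc hl, sum_range_succ_eq_ends_add_sum_Icc hl] at key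
  simp only [Prod.swap, Nat.sub_zero, Nat.sub_self, Spoly_zero, Tpoly_zero, pow_zero, one_mul,
    mul_one, zero_mul, add_zero, zero_add, Nat.cast_zero] at key
  simp only [sub_add_cancel]
  convert key using 3
  · refine Finset.sum_congr rfl fun j hj => ?_
    rw [Nat.cast_sub (by rw [Finset.mem_Icc] at hj; lia)]
    ring
  · refine Finset.sum_congr rfl fun j _ => ?_
    rw [add_right_comm]
    ring
end

section
/- For all integers l ≥ 1, s ≥ 0 and all i ∈ ℤ the alternating relation S^l_s(i) + Σ_{j=1}^{l−1} (−1)^j S^{l−j}_s(i + jn) T^j_s(i) + (−1)^l T^l_s(i) = 0 holds. -/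
variable {R : Type*} [CommRing R]

/-- The product of a `Tpoly` and a shifted `Spoly` is a sum over `j + k`-tuples whose first `j`
entries are strictly increasing and whose last `k` entries are weakly decreasing. -/
theorem Spoly_mul_Tpoly (n p : ℤ) (r : ℤ → R) (j k : ℕ) (s i : ℤ) :
    Spoly n p r k s (i + (j : ℤ) * n) * Tpoly n p r j s i =
      ∑ lam ∈ Finset.filter (fun lam : Fin (j + k) → ℤ =>
          (∀ a b : Fin (j + k), a < b → (b : ℕ) < j → lam a < lam b) ∧
          (∀ a b : Fin (j + k), a ≤ b → j ≤ (a : ℕ) → lam b ≤ lam a))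
        (Fintype.piFinset fun _ : Fin (j + k) => Finset.Icc (1 : ℤ) (s + 1)),
      ∏ a : Fin (j + k), r (i + (p - n) * lam a + (((a : ℕ) : ℤ) + 1) * n - p) := by
  rw [mul_comm, Spoly, Tpoly, Finset.sum_mul_sum, ← Finset.sum_product']
  refine Finset.sum_nbij' (fun x => Fin.append x.1 x.2)
    (fun lam => (fun a => lam (Fin.castAdd k a), fun a => lam (Fin.natAdd j a))) ?_ ?_ ?_ ?_ ?_
  · rintro ⟨x, y⟩ h
    simp only [Finset.mem_product, Finset.mem_filter, Fintype.mem_piFinset] at h ⊢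
    obtain ⟨⟨hx, hx'⟩, hy, hy'⟩ := h
    refine ⟨fun a => ?_, fun a b => ?_, fun a b => ?_⟩
    · induction a using Fin.addCases <;> simp only [Fin.append_left, Fin.append_right, hx, hy]
    · induction a using Fin.addCases <;> induction b using Fin.addCases <;>
        simp only [Fin.append_left, Fin.append_right, Fin.lt_def, Fin.val_castAdd, Fin.val_natAdd]
      · exact fun h _ => hx' _ _ h
      all_goals omega
    · induction a using Fin.addCases <;> induction b using Fin.addCases <;>
        simp only [Fin.append_left, Fin.append_right, Fin.le_def, Fin.val_castAdd, Fin.val_natAdd]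
      any_goals omega
      exact fun h _ => hy' _ _ (Fin.le_def.2 (by omega))
  · intro lam h
    simp only [Finset.mem_product, Finset.mem_filter, Fintype.mem_piFinset] at h ⊢
    obtain ⟨h, hT, hS⟩ := h
    refine ⟨⟨fun a => h _, fun a b hab => hT _ _ ?_ ?_⟩, fun a => h _, fun a b hab => hS _ _ ?_ ?_⟩
    all_goals simp only [Fin.lt_def, Fin.le_def, Fin.val_castAdd, Fin.val_natAdd] at hab ⊢
    all_goals omega
  · rintro ⟨x, y⟩ _
    simp
  · intro lam _
    exact Fin.append_castAdd_natAdd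
  · rintro ⟨x, y⟩ _
    rw [Fin.prod_univ_add]
    congr 1
    · simp
    · refine Finset.prod_congr rfl fun a _ => congrArg r ?_
      simp only [Fin.append_right, Fin.val_natAdd, Nat.cast_add]
      ring

theorem sum_range_alternating_add (u : ℕ → R) (m : ℕ) :
    ∑ j ∈ Finset.range m, (-1 : R) ^ j * (u j + u (j + 1)) = u 0 - (-1 : R) ^ m * u m := by
  induction m with
  | zero => simp
  | succ m ih => rw [Finset.sum_range_succ, ih, pow_succ]; ring

open Classical in
/-- For a nonempty tuple, the signed number of ways of cutting it into a strictly increasing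
initial part and a weakly decreasing final part vanishes. -/
theorem sum_alternating_cut_eq_zero {l : ℕ} (hl : 1 ≤ l) (lam : Fin l → ℤ) :
    ∑ j ∈ Finset.range (l + 1), (-1 : R) ^ j *
      (if (∀ a b : Fin l, a < b → (b : ℕ) < j → lam a < lam b) ∧
          (∀ a b : Fin l, a ≤ b → j ≤ (a : ℕ) → lam b ≤ lam a) then 1 else 0) = 0 := by
  let U : ℕ → Prop := fun j => (1 ≤ j ∧ j ≤ l) ∧
    (∀ a b : Fin l, a < b → (b : ℕ) < j → lam a < lam b) ∧
    (∀ a b : Fin l, a ≤ b → j ≤ (a : ℕ) + 1 → lam b ≤ lam a)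
  have key := sum_range_alternating_add (fun j => if U j then (1 : R) else 0) (l + 1)
  have h0 : ¬ U 0 := fun h => by have := h.1.1; omega
  have h1 : ¬ U (l + 1) := fun h => by have := h.1.2; omega
  simp only [h0, h1, if_false, mul_zero, sub_zero] at key
  rw [← key]
  refine Finset.sum_congr rfl fun j hj => ?_
  congr 1
  have hjl : j ≤ l := by simpa [Nat.lt_succ_iff] using hj
  have hdisj : ¬ (U j ∧ U (j + 1)) := by
    rintro ⟨⟨⟨hj1, -⟩, -, hS⟩, ⟨-, hj2⟩, hT, -⟩
    have e1 := hS ⟨j - 1, by omega⟩ ⟨j, by omega⟩ (Fin.le_def.2 (by simp)) (by simp; omega)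
    have e2 := hT ⟨j - 1, by omega⟩ ⟨j, by omega⟩ (Fin.lt_def.2 (by simp; omega)) (by simp)
    omega
  have hiff : ((∀ a b : Fin l, a < b → (b : ℕ) < j → lam a < lam b) ∧
      (∀ a b : Fin l, a ≤ b → j ≤ (a : ℕ) → lam b ≤ lam a)) ↔ U j ∨ U (j + 1) := by
    constructor
    · rintro ⟨hT, hS⟩
      by_cases hc : 1 ≤ j ∧ (∀ h : j < l, lam ⟨j, h⟩ ≤ lam ⟨j - 1, by omega⟩)
      · refine Or.inl ⟨⟨hc.1, hjl⟩, hT, fun a b hab ha => ?_⟩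
        rcases Nat.lt_or_ge a j with haj | haj
        · rcases eq_or_lt_of_le hab with rfl | hlt
          · rfl
          · have hb : j ≤ (b : ℕ) := by have := Fin.lt_def.1 hlt; omega
            have ha' : a = ⟨j - 1, by omega⟩ := Fin.ext (by simp; omega)
            rw [ha']
            exact (hS ⟨j, by omega⟩ b (Fin.le_def.2 hb) le_rfl).trans (hc.2 (by omega))
        · exact hS a b hab haj
      · have hj' : j < l := by
          by_contra hjn
          exact hc ⟨by omega, fun h => absurd h hjn⟩
        refine Or.inr ⟨⟨by omega, hj'⟩, fun a b hab hb => ?_, fun a b hab ha => hS a b hab (by omega)⟩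
        have hab' := Fin.lt_def.1 hab
        rcases Nat.lt_or_ge b j with hbj | hbj
        · exact hT a b hab hbj
        · have hb' : b = ⟨j, hj'⟩ := Fin.ext (by simp; omega)
          have hlt : lam ⟨j - 1, by omega⟩ < lam ⟨j, hj'⟩ := by
            by_contra hn
            exact hc ⟨by omega, fun _ => not_lt.1 hn⟩
          rw [hb']
          rcases Nat.lt_or_ge a (j - 1) with haj | haj
          · exact (hT a ⟨j - 1, by omega⟩ (Fin.lt_def.2 haj) (by simp; omega)).trans hlt
          · have ha' : a = ⟨j - 1, by omega⟩ := Fin.ext (by simp; omega)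
            rw [ha']
            exact hlt
    · rintro (⟨-, hT, hS⟩ | ⟨-, hT, hS⟩)
      · exact ⟨hT, fun a b hab ha => hS a b hab (by omega)⟩
      · exact ⟨fun a b hab hb => hT a b hab (by omega), fun a b hab ha => hS a b hab (by omega)⟩
  simp only [hiff]
  by_cases hU : U j <;> by_cases hU' : U (j + 1) <;> simp_all

theorem sum_range_alternating_Spoly_mul_Tpoly (n p : ℤ) (r : ℤ → R) {l : ℕ} (hl : 1 ≤ l)
    (s i : ℤ) :
    ∑ j ∈ Finset.range (l + 1), (-1 : R) ^ j *
      (Spoly n p r (l - j) s (i + (j : ℤ) * n) * Tpoly n p r j s i) = 0 := by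
  classical
  have hprod : ∀ j ∈ Finset.range (l + 1),
      (-1 : R) ^ j * (Spoly n p r (l - j) s (i + (j : ℤ) * n) * Tpoly n p r j s i) =
      ∑ lam ∈ Fintype.piFinset fun _ : Fin l => Finset.Icc (1 : ℤ) (s + 1),
        ((-1 : R) ^ j *
          (if (∀ a b : Fin l, a < b → (b : ℕ) < j → lam a < lam b) ∧
            (∀ a b : Fin l, a ≤ b → j ≤ (a : ℕ) → lam b ≤ lam a) then 1 else 0)) *
        ∏ a : Fin l, r (i + (p - n) * lam a + (((a : ℕ) : ℤ) + 1) * n - p) := by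
    intro j hj
    obtain ⟨k, rfl⟩ := Nat.exists_eq_add_of_le (Nat.lt_succ_iff.1 (Finset.mem_range.1 hj))
    rw [Nat.add_sub_cancel_left, Spoly_mul_Tpoly, Finset.sum_filter, Finset.mul_sum]
    refine Finset.sum_congr rfl fun lam _ => ?_
    rw [mul_assoc, ite_mul, one_mul, zero_mul]
  rw [Finset.sum_congr rfl hprod, Finset.sum_comm]
  refine Finset.sum_eq_zero fun lam _ => ?_
  rw [← Finset.sum_mul, sum_alternating_cut_eq_zero hl, zero_mul]

/-- Second alternating relation of the paper: for `l ≥ 1`, `s ≥ 0` and all `i ∈ ℤ`,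
`S^l_s(i) + Σ_{j=1}^{l-1} (-1)^j S^{l-j}_s(i + jn) T^j_s(i) + (-1)^l T^l_s(i) = 0`. -/
theorem ST_alternating_second (n p : ℤ) (hn : 1 ≤ n) (hp : n < p) (r : ℤ → R)
    (l : ℕ) (hl : 1 ≤ l) (s : ℤ) (hs : 0 ≤ s) (i : ℤ) :
    Spoly n p r l s i
      + (∑ j ∈ Finset.Icc 1 (l - 1), (-1 : R) ^ j * Spoly n p r (l - j) s (i + (j : ℤ) * n)
          * Tpoly n p r j s i)
      + (-1 : R) ^ l * Tpoly n p r l s i = 0 := by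
  have h := sum_range_alternating_Spoly_mul_Tpoly n p r hl s i
  obtain ⟨m, rfl⟩ := Nat.exists_eq_add_of_le' hl
  rw [Finset.sum_range_succ, Finset.range_eq_Ico, Finset.sum_eq_sum_Ico_succ_bot (by omega)] at h
  have hI : Finset.Ico (0 + 1) (m + 1) = Finset.Icc 1 (m + 1 - 1) := by
    ext j
    simp only [Finset.mem_Ico, Finset.mem_Icc]
    omega
  rw [hI] at h
  simpa [Spoly_zero, Tpoly_zero, mul_assoc] using h
end
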